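/- arXiv:1104.1364 — 2 statements merged into one kernel-verified Lean document; each statement's English description precedes it below -/
import Mathlib

section
/- The trace of the wave group Θ(t) = ∑_{n=1}^∞ d(n) e^{-nt} satisfies Θ(t) = -(ln t)/t + γ/t + 1/4 + O(t) as t → 0⁺. -/
open Filter Asymptotics

noncomputable def wE (x : ℝ) : ℝ := dslope Real.exp 0 x

lemma dslope_an {f : ℝ → ℝ} (hf : ∀ x, AnalyticAt ℝ f x) (x : ℝ) : AnalyticAt ℝ (dslope f 0) x := by
  by_cases hx : x = 0
  · subst hx
    obtain ⟨p, hp⟩ := hf 0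
    exact ⟨_, hp.has_fpower_series_dslope_fslope⟩
  · have h1 : AnalyticAt ℝ (fun y => y⁻¹ * (f y - f 0)) x :=
      (analyticAt_id.inv hx).mul ((hf x).sub analyticAt_const)
    refine h1.congr ?_
    filter_upwards [isOpen_ne.mem_nhds hx] with y hy
    rw [dslope_of_ne _ hy, slope_def_field]
    simp [div_eq_mul_inv, mul_comm]

lemma wE_an (x : ℝ) : AnalyticAt ℝ wE x := dslope_an (fun _ => analyticAt_rexp) x

lemma wE_mul (x : ℝ) : x * wE x = Real.exp x - 1 := by
  have := sub_smul_dslope Real.exp 0 x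
  simpa [wE] using this

lemma wE_zero : wE 0 = 1 := by simp [wE]

lemma wE_pos (x : ℝ) : 0 < wE x := by
  have h := wE_mul x
  rcases lt_trichotomy x 0 with hx | hx | hx
  · have : Real.exp x < 1 := Real.exp_lt_one_iff.2 hx
    nlinarith
  · rw [hx, wE_zero]; norm_num
  · have : 1 < Real.exp x := Real.one_lt_exp_iff.2 hx
    by_contra! h'
    nlinarith

lemma wE_contDiff : ContDiff ℝ 2 wE := contDiff_iff_contDiffAt.2 fun x => (wE_an x).contDiffAt

lemma wE_deriv : HasDerivAt wE (1/2) 0 := by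
  have hd : ∀ x, HasDerivAt wE (deriv wE x) x := fun x => (wE_an x).differentiableAt.hasDerivAt
  have hd2 : HasDerivAt (deriv wE) (deriv (deriv wE) 0) 0 :=
    (wE_an 0).deriv.differentiableAt.hasDerivAt
  have h1 : ∀ x, wE x + x * deriv wE x = Real.exp x := by
    intro x
    have a := (hasDerivAt_id x).mul (hd x)
    have b := (Real.hasDerivAt_exp x).sub_const 1
    have : (id * wE) = fun x => Real.exp x - 1 := by ext y; simp [← wE_mul]
    rw [this] at a
    simpa using a.unique b
  have a := (hd 0).add ((hasDerivAt_id (0:ℝ)).mul hd2)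
  have b := Real.hasDerivAt_exp 0
  have : (wE + id * deriv wE) = Real.exp := by ext y; simp [← h1]
  rw [this] at a
  have := a.unique b
  simp at this
  have h := hd 0
  rwa [show deriv wE 0 = 1/2 by linarith] at h

noncomputable def wF (x : ℝ) : ℝ := (wE x)⁻¹ - Real.exp (-x)
noncomputable def wG (x : ℝ) : ℝ := dslope wF 0 x

lemma wF_an (x : ℝ) : AnalyticAt ℝ wF x :=
  ((wE_an x).inv (wE_pos x).ne').sub (analyticAt_rexp.fun_comp analyticAt_id.neg)

lemma wG_an (x : ℝ) : AnalyticAt ℝ wG x := dslope_an wF_an x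

lemma wG_zero : wG 0 = 1/2 := by
  have h : HasDerivAt wF (-(1/2) / (wE 0)^2 - Real.exp (-0) * (-1)) 0 :=
    (wE_deriv.inv (wE_pos 0).ne').sub ((hasDerivAt_neg (0:ℝ)).exp)
  simp only [wG, dslope_same]
  rw [h.deriv, wE_zero]; norm_num

lemma wG_eq {x : ℝ} (hx : 0 < x) :
    wG x = Real.exp (-x) / (1 - Real.exp (-x)) - Real.exp (-x) / x := by
  have h : x * wG x = wF x := by
    have := sub_smul_dslope wF 0 x
    simpa [wG, wF, wE_zero] using this
  have h2 := wE_mul x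
  have h3 : wE x = (Real.exp x - 1) / x := by field_simp; linarith
  have h5 : 1 < Real.exp x := Real.one_lt_exp_iff.2 hx
  have h6 : Real.exp x - 1 ≠ 0 := by linarith
  have h4 : wG x = wF x / x := by field_simp; linarith
  rw [h4, wF, h3, Real.exp_neg]
  field_simp

lemma one_sub_pos {x : ℝ} (hx : 0 < x) : 0 < 1 - Real.exp (-x) := by
  have : Real.exp (-x) < 1 := Real.exp_lt_one_iff.2 (by linarith)
  linarith

lemma wG_d1 {x : ℝ} (hx : 0 < x) : HasDerivAt wG
    (-Real.exp (-x) / (1 - Real.exp (-x))^2 + Real.exp (-x) / x + Real.exp (-x) / x^2) x := by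
  have h0 := (one_sub_pos hx).ne'
  have hq : HasDerivAt (fun x : ℝ => Real.exp (-x)) (Real.exp (-x) * (-1)) x := (hasDerivAt_neg x).exp
  have h := (hq.div (hq.const_sub 1) h0).sub (hq.div (hasDerivAt_id x) hx.ne')
  refine (h.congr_of_eventuallyEq ?_).congr_deriv ?_
  · filter_upwards [isOpen_Ioi.mem_nhds hx] with y hy
    simpa using wG_eq hy
  · simp; field_simp; ring

lemma wG_d2 {x : ℝ} (hx : 0 < x) : deriv (deriv wG) x =
    Real.exp (-x) * ((1 + Real.exp (-x)) / (1 - Real.exp (-x))^3 - (1/x+2/x^2+2/x^3)) := by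
  have h0 := (one_sub_pos hx).ne'
  have hq : HasDerivAt (fun x : ℝ => Real.exp (-x)) (Real.exp (-x) * (-1)) x := (hasDerivAt_neg x).exp
  have h := ((hq.neg.div ((hq.const_sub 1).pow 2) (pow_ne_zero 2 h0)).add (hq.div (hasDerivAt_id x) hx.ne')).add
    (hq.div ((hasDerivAt_id x).pow 2) (pow_ne_zero 2 hx.ne'))
  refine ((h.congr_of_eventuallyEq ?_).congr_deriv ?_).deriv
  · filter_upwards [isOpen_Ioi.mem_nhds hx] with y hy
    simpa using (wG_d1 hy).deriv
  · simp; field_simp; ring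

lemma wG_bound : ∃ K : ℝ, 0 ≤ K ∧ ∀ x, 0 ≤ x → |deriv (deriv wG) x| ≤ K * Real.exp (-x) := by
  have hc : Continuous (fun x => deriv (deriv wG) x * Real.exp x) := by
    refine Continuous.mul ?_ Real.continuous_exp
    exact continuous_iff_continuousAt.2 fun x => (wG_an x).deriv.deriv.continuousAt
  obtain ⟨C, hC⟩ := (isCompact_Icc (a := (0:ℝ)) (b := 1)).exists_bound_of_continuousOn hc.continuousOn
  refine ⟨max C 16, by positivity, fun x hx => ?_⟩
  rcases le_total x 1 with h | h
  · have := hC x ⟨hx, h⟩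
    rw [norm_mul, Real.norm_eq_abs, Real.norm_eq_abs, abs_of_pos (Real.exp_pos x)] at this
    rw [Real.exp_neg, ← div_eq_mul_inv, le_div_iff₀ (Real.exp_pos x)]
    exact this.trans (le_max_left _ _)
  · have hx0 : 0 < x := by linarith
    rw [wG_d2 hx0, abs_mul, abs_of_pos (Real.exp_pos _), mul_comm]
    refine mul_le_mul_of_nonneg_right (le_trans ?_ (le_max_right _ _)) (Real.exp_pos _).le
    have hq : Real.exp (-x) ≤ 1/2 := by
      rw [Real.exp_neg, inv_le_comm₀ (Real.exp_pos x) (by norm_num)]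
      have := Real.add_one_le_exp x
      norm_num; linarith
    have hq0 := Real.exp_pos (-x)
    set q := Real.exp (-x)
    have e1 : (1 + q) / (1 - q)^3 ≤ 12 := by
      have : (1/2:ℝ)^3 ≤ (1-q)^3 := by gcongr; linarith
      rw [div_le_iff₀ (by linarith)]; norm_num at this; linarith
    have e0 : 0 ≤ (1 + q) / (1 - q)^3 := by
      have : 0 < 1 - q := by linarith
      positivity
    have e2 : 1/x ≤ 1 := by rw [div_le_iff₀ hx0]; linarith
    have e3 : 2/x^2 ≤ 2 := by rw [div_le_iff₀ (by positivity)]; nlinarith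
    have e4 : 2/x^3 ≤ 2 := by
      rw [div_le_iff₀ (by positivity)]
      have := one_le_pow₀ h (n := 3); linarith
    have : 0 ≤ 1/x + 2/x^2+2/x^3 := by positivity
    rw [abs_le]; constructor <;> linarith

lemma wG_cont : Continuous wG := continuous_iff_continuousAt.2 fun x => (wG_an x).continuousAt

lemma wE_cont : Continuous wE := continuous_iff_continuousAt.2 fun x => (wE_an x).continuousAt

lemma explog_ii (a b : ℝ) :
    IntervalIntegrable (fun u => Real.exp (-u) * Real.log u) MeasureTheory.volume a b := by
  refine IntervalIntegrable.continuousOn_mul intervalIntegral.intervalIntegrable_log' ?_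
  exact (by fun_prop : Continuous fun u : ℝ => Real.exp (-u)).continuousOn

lemma explog_lim : Tendsto (fun R : ℝ => ∫ u in (0:ℝ)..R, Real.exp (-u) * Real.log u) atTop
    (nhds (-Real.eulerMascheroniConstant)) := by
  have h := mellin_hasDerivAt_of_isBigO_rpow (E := ℂ) (a := 2) (b := 0) (s := 1)
    (f := fun t : ℝ => ((Real.exp (-t) : ℝ) : ℂ)) ?_ ?_ (by norm_num) ?_ (by norm_num)
  rotate_left
  · refine (Continuous.continuousOn ?_).locallyIntegrableOn measurableSet_Ioi
    exact Complex.continuous_ofReal.comp (Real.continuous_exp.comp continuous_neg)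
  · rw [← isBigO_norm_left]
    simp_rw [Complex.norm_real, isBigO_norm_left]
    simpa only [neg_one_mul] using (isLittleO_exp_neg_mul_rpow_atTop zero_lt_one _).isBigO
  · simp_rw [neg_zero, Real.rpow_zero]
    refine isBigO_const_of_tendsto (?_ : Tendsto _ _ (nhds (1 : ℂ))) one_ne_zero
    rw [(by simp : (1 : ℂ) = Real.exp (-0))]
    exact (Complex.continuous_ofReal.comp (Real.continuous_exp.comp continuous_neg)).continuousWithinAt
  obtain ⟨h1, h2⟩ := h
  have e : ∀ t : ℝ, (t:ℂ) ^ ((1:ℂ) - 1) • Real.log t • ((Real.exp (-t) : ℝ) : ℂ)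
      = ((Real.exp (-t) * Real.log t : ℝ) : ℂ) := by
    intro t; simp [mul_comm]
  simp only [MellinConvergent, mellin, e] at h1 h2
  have hi : MeasureTheory.IntegrableOn (fun t : ℝ => Real.exp (-t) * Real.log t) (Set.Ioi 0) := by
    have := h1.re
    simp only [RCLike.re_to_complex, Complex.ofReal_re] at this
    exact this
  have h3 : HasDerivAt Complex.Gamma
      (∫ t : ℝ in Set.Ioi 0, ((Real.exp (-t) * Real.log t : ℝ) : ℂ)) 1 := by
    have h2' := h2
    refine HasDerivAt.congr_of_eventuallyEq h2' ?_
    have : {s : ℂ | 0 < s.re} ∈ nhds (1:ℂ) :=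
      (isOpen_lt continuous_const Complex.continuous_re).mem_nhds (by simp)
    filter_upwards [this] with s hs
    rw [Complex.Gamma_eq_integral hs, Complex.GammaIntegral_eq_mellin]
  have h4 := h3.unique Complex.hasDerivAt_Gamma_one
  rw [integral_complex_ofReal] at h4
  have h5 : ∫ t : ℝ in Set.Ioi 0, Real.exp (-t) * Real.log t = -Real.eulerMascheroniConstant := by
    exact_mod_cast h4
  rw [← h5]
  exact MeasureTheory.intervalIntegral_tendsto_integral_Ioi 0 hi tendsto_id

noncomputable def wH (x : ℝ) : ℝ :=
  Real.log (wE (-x)) + wE (-x) * (x * Real.log x) - ∫ u in (0:ℝ)..x, Real.exp (-u) * Real.log u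

lemma wH_cont : Continuous wH := by
  have h1 : Continuous fun x => wE (-x) := wE_cont.comp continuous_neg
  refine ((h1.log fun x => (wE_pos _).ne').add (h1.mul Real.continuous_mul_log)).sub ?_
  exact intervalIntegral.continuous_primitive (fun a b => explog_ii a b) 0

lemma wE_neg_eq {x : ℝ} (hx : 0 < x) : wE (-x) = (1 - Real.exp (-x)) / x := by
  have := wE_mul (-x)
  field_simp; linarith

lemma wH_eq {x : ℝ} (hx : 0 < x) : wH x = Real.log (1 - Real.exp (-x)) - Real.exp (-x) * Real.log x
    - ∫ u in (0:ℝ)..x, Real.exp (-u) * Real.log u := by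
  rw [wH, wE_neg_eq hx, Real.log_div (one_sub_pos hx).ne' hx.ne']
  field_simp
  ring

lemma wH_deriv {x : ℝ} (hx : 0 < x) : HasDerivAt wH (wG x) x := by
  have h0 := (one_sub_pos hx).ne'
  have hq : HasDerivAt (fun x : ℝ => Real.exp (-x)) (Real.exp (-x) * (-1)) x := (hasDerivAt_neg x).exp
  have hJ : HasDerivAt (fun x => ∫ u in (0:ℝ)..x, Real.exp (-u) * Real.log u)
      (Real.exp (-x) * Real.log x) x := by
    refine intervalIntegral.integral_hasDerivAt_right (explog_ii 0 x) ?_ ?_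
    · refine ContinuousAt.stronglyMeasurableAtFilter (s := Set.Ioi 0) isOpen_Ioi ?_ x hx
      intro y hy
      have : y ≠ 0 := ne_of_gt hy
      fun_prop (disch := assumption)
    · have : x ≠ 0 := hx.ne'
      fun_prop (disch := assumption)
  have h := (((hq.const_sub 1).log h0).sub (hq.mul (Real.hasDerivAt_log hx.ne'))).sub hJ
  refine (h.congr_of_eventuallyEq ?_).congr_deriv ?_
  · filter_upwards [isOpen_Ioi.mem_nhds hx] with y hy
    simpa using wH_eq hy
  · rw [wG_eq hx]; field_simp; ring

lemma wG_int {R : ℝ} (hR : 0 ≤ R) : ∫ x in (0:ℝ)..R, wG x = wH R := by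
  rw [intervalIntegral.integral_eq_sub_of_hasDerivAt_of_le hR wH_cont.continuousOn
    (fun x hx => wH_deriv hx.1) (wG_cont.intervalIntegrable _ _)]
  simp [wH, wE_zero]

lemma q_lim : Tendsto (fun x : ℝ => Real.exp (-x)) atTop (nhds 0) :=
  Real.tendsto_exp_neg_atTop_nhds_zero

lemma wH_lim : Tendsto wH atTop (nhds Real.eulerMascheroniConstant) := by
  have h1 : Tendsto (fun x : ℝ => Real.log (1 - Real.exp (-x))) atTop (nhds 0) := by
    have := (q_lim.const_sub 1)
    have := this.log (by norm_num)
    simpa using this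
  have h2 : Tendsto (fun x : ℝ => Real.exp (-x) * Real.log x) atTop (nhds 0) := by
    have a := Real.tendsto_pow_mul_exp_neg_atTop_nhds_zero 1
    refine squeeze_zero' ?_ ?_ a
    · filter_upwards [eventually_ge_atTop 1] with x hx
      have := Real.log_nonneg hx
      positivity
    · filter_upwards [eventually_ge_atTop 1] with x hx
      rw [pow_one, mul_comm]
      gcongr
      exact Real.log_le_self (by linarith)
  have h := (h1.sub h2).sub explog_lim
  simp only [sub_zero, zero_sub, neg_neg] at h
  refine h.congr' ?_
  filter_upwards [eventually_gt_atTop 0] with x hx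
  exact (wH_eq hx).symm

lemma wG_lim : Tendsto wG atTop (nhds 0) := by
  have h := (q_lim.div (q_lim.const_sub 1) (by norm_num)).sub (q_lim.div_atTop tendsto_id)
  simp only [sub_zero, zero_div] at h
  refine h.congr' ?_
  filter_upwards [eventually_gt_atTop 0] with x hx
  simpa using (wG_eq hx).symm

lemma wG_trap {K : ℝ} (hK0 : 0 ≤ K) (hK : ∀ x, 0 ≤ x → |deriv (deriv wG) x| ≤ K * Real.exp (-x))
    {a t : ℝ} (ha : 0 ≤ a) (ht : 0 < t) :
    |t * (wG a + wG (a + t)) / 2 - ∫ x in a..(a+t), wG x| ≤ t^3 / 12 * (K * Real.exp (-a)) := by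
  have hab : a < a + t := by linarith
  have hc : ContDiff ℝ 2 wG := contDiff_iff_contDiffAt.2 fun x => (wG_an x).contDiffAt
  have hu := uniqueDiffOn_Icc hab
  have hd : ∀ x ∈ Set.Icc a (a+t), derivWithin wG (Set.Icc a (a+t)) x = deriv wG x := fun x hx =>
    (wG_an x).differentiableAt.derivWithin (hu x hx)
  have h := trapezoidal_error_le (f := wG) (a := a) (b := a + t) (ζ := K * Real.exp (-a)) (N := 1)
    ?_ ?_ ?_ one_pos
  · simp only [trapezoidal_error, trapezoidal_integral] at h
    simp only [add_sub_cancel_left, abs_of_pos ht] at h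
    simp at h
    rw [show t * (wG a + wG (a + t)) / 2 = t * ((wG a + wG (a + t)) / 2) by ring]
    refine h.trans (le_of_eq ?_)
    ring
  · exact (hc.differentiable (by norm_num)).differentiableOn
  · rw [Set.uIcc_of_lt hab]
    refine DifferentiableOn.congr (f := deriv wG) ?_ hd
    exact fun x _ => (wG_an x).deriv.differentiableAt.differentiableWithinAt
  · rw [Set.uIcc_of_lt hab]
    intro x
    by_cases hx : x ∈ Set.Icc a (a+t)
    · rw [iteratedDerivWithin_eq_iteratedDeriv hu hc.contDiffAt hx, iteratedDeriv_succ, iteratedDeriv_one]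
      refine (hK x (ha.trans hx.1)).trans ?_
      gcongr
      exact hx.1
    · rw [iteratedDerivWithin_succ, derivWithin_zero_of_notMem_closure]
      · simp; positivity
      · rwa [isClosed_Icc.closure_eq]

lemma wG_sum {K : ℝ} (hK0 : 0 ≤ K) (hK : ∀ x, 0 ≤ x → |deriv (deriv wG) x| ≤ K * Real.exp (-x))
    {t : ℝ} (ht : 0 < t) (N : ℕ) :
    |t * (∑ m ∈ Finset.range N, wG ((m + 1) * t)) + t / 2 * (1 / 2 - wG (N * t)) - wH (N * t)|
      ≤ t^3 / 12 * K * ∑ m ∈ Finset.range N, Real.exp (-t) ^ m := by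
  rw [← wG_int (by positivity)]
  induction N with
  | zero => simp [wG_zero]
  | succ N ih =>
    have h := wG_trap hK0 hK (a := N * t) (by positivity) ht
    rw [Finset.sum_range_succ, Finset.sum_range_succ, mul_add, ← Real.exp_nat_mul]
    have e : ((N + 1 : ℕ) : ℝ) * t = N * t + t := by push_cast; ring
    have e' : ((N : ℝ) + 1) * t = N * t + t := by ring
    rw [e, e', ← intervalIntegral.integral_add_adjacent_intervals (wG_cont.intervalIntegrable 0 (N * t))
      (wG_cont.intervalIntegrable _ _)]
    rw [show (N:ℝ) * -t = -(N * t) by ring]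
    have := abs_add_le (t * (∑ m ∈ Finset.range N, wG ((m + 1) * t)) + t / 2 * (1 / 2 - wG (N * t)) - ∫ x in (0:ℝ)..(N * t), wG x) (t * (wG (N * t) + wG (N * t + t)) / 2 - ∫ x in (N * t)..(N * t+t), wG x)
    refine le_trans (le_of_eq ?_) (this.trans ((add_le_add ih h).trans (le_of_eq ?_)))
    · congr 1; ring
    · ring

lemma q_half {t : ℝ} (ht : 0 < t) (ht1 : t ≤ 1) : t / 2 ≤ 1 - Real.exp (-t) := by
  have h := Real.add_one_le_exp t
  have : Real.exp (-t) ≤ (t+1)⁻¹ := by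
    rw [Real.exp_neg]; gcongr
  have h2 : (t+1)⁻¹ ≤ 1 - t/2 := by
    rw [inv_le_iff_one_le_mul₀ (by linarith)]; nlinarith
  linarith

lemma wG_final {K : ℝ} (hK0 : 0 ≤ K) (hK : ∀ x, 0 ≤ x → |deriv (deriv wG) x| ≤ K * Real.exp (-x))
    {t : ℝ} (ht : 0 < t) (ht1 : t ≤ 1) {S : ℝ} (hS : HasSum (fun m : ℕ => wG ((m + 1) * t)) S) :
    |S - (Real.eulerMascheroniConstant / t - 1 / 4)| ≤ K * t := by
  have hNt : Tendsto (fun N : ℕ => (N:ℝ) * t) atTop atTop :=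
    tendsto_natCast_atTop_atTop.atTop_mul_const ht
  have l := (((hS.tendsto_sum_nat.const_mul t).add
    (((wG_lim.comp hNt).const_sub (1/2)).const_mul (t/2))).sub (wH_lim.comp hNt)).abs
  have hb : ∀ N : ℕ, t^3 / 12 * K * ∑ m ∈ Finset.range N, Real.exp (-t) ^ m ≤ t^2 * K := by
    intro N
    have hq := q_half ht ht1
    have h0 : ∑ m ∈ Finset.range N, Real.exp (-t) ^ m ≤ 2 / t := by
      rw [geom_sum_eq (by linarith)]
      rw [← neg_div_neg_eq, neg_sub, neg_sub]
      rw [div_le_div_iff₀ (by linarith) ht]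
      have : 0 ≤ Real.exp (-t) ^ N := by positivity
      nlinarith
    calc _ ≤ t^3 / 12 * K * (2 / t) := by gcongr
      _ = t^2 * K / 6 := by field_simp; ring
      _ ≤ _ := by nlinarith [mul_nonneg (sq_nonneg t) hK0]
  have := le_of_tendsto' l (fun N => (wG_sum hK0 hK ht N).trans (hb N))
  have e : t * S + t / 2 * (1 / 2 - 0) - Real.eulerMascheroniConstant =
    t * (S - (Real.eulerMascheroniConstant / t - 1 / 4)) := by field_simp; ring
  rw [e, abs_mul, abs_of_pos ht] at this
  refine le_of_mul_le_mul_left (this.trans (le_of_eq ?_)) ht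
  ring

lemma log_bound {t : ℝ} (ht : 0 < t) :
    |-Real.log (1 - Real.exp (-t)) / t - (-Real.log t / t + 1 / 2)| ≤ t := by
  set s := t / 2 with hs
  have hs0 : 0 < s := by positivity
  have h1 : s ≤ Real.sinh s := Real.self_le_sinh_iff.2 hs0.le
  have h2 : Real.sinh s ≤ s * Real.cosh s := by
    have hm : MonotoneOn (fun x : ℝ => x * Real.cosh x - Real.sinh x) (Set.Ici 0) := by
      refine monotoneOn_of_deriv_nonneg (convex_Ici 0) (by fun_prop) (by fun_prop) ?_
      intro x hx
      rw [interior_Ici] at hx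
      have hx : 0 < x := hx
      have := (((hasDerivAt_id x).mul (Real.hasDerivAt_cosh x)).sub (Real.hasDerivAt_sinh x)).deriv
      have e : (fun x : ℝ => x * Real.cosh x - Real.sinh x) = id * Real.cosh - Real.sinh := by
        ext; simp
      rw [e, this]
      have : 0 ≤ Real.sinh x := Real.sinh_nonneg_iff.2 hx.le
      simp; positivity
    have := hm (Set.self_mem_Ici) (Set.mem_Ici.2 hs0.le) hs0.le
    simp at this; linarith
  have h3 := Real.cosh_le_exp_half_sq s
  have e : 1 - Real.exp (-t) = t * (Real.exp (-s) * (Real.sinh s / s)) := by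
    rw [Real.sinh_eq, show t = s + s by rw [hs]; ring, neg_add, Real.exp_add, Real.exp_neg]
    field_simp; ring
  have p : 0 < Real.sinh s := by linarith
  rw [e, Real.log_mul ht.ne' (by positivity), Real.log_mul (by positivity) (by positivity), Real.log_exp]
  have l1 : 0 ≤ Real.log (Real.sinh s / s) := Real.log_nonneg (by rwa [one_le_div hs0])
  have l2 : Real.log (Real.sinh s / s) ≤ s^2/2 := by
    rw [Real.log_le_iff_le_exp (by positivity)]
    refine le_trans ?_ h3
    rw [div_le_iff₀ hs0]; linarith
  set L := Real.log (Real.sinh s / s)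
  have : -(Real.log t + (-s + L)) / t - (-Real.log t / t + 1 / 2) = - (L / t) := by
    rw [hs]; field_simp; ring
  rw [this, abs_neg, abs_of_nonneg (by positivity), div_le_iff₀ ht]
  rw [hs] at l2; nlinarith

lemma theta_hasSum {t : ℝ} (ht : 0 < t) : ∃ S, HasSum (fun m : ℕ => wG ((m + 1) * t)) S ∧
    (∑' n : ℕ, ((Nat.divisors (n + 1)).card : ℝ) * Real.exp (-(((n : ℝ) + 1) * t))) =
      S + -Real.log (1 - Real.exp (-t)) / t := by
  have hp := one_sub_pos ht
  have hq0 := Real.exp_pos (-t)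
  have hr : ‖Real.exp (-t)‖ < 1 := by
    rw [Real.norm_eq_abs, abs_of_pos hq0]; linarith
  have hpow : ∀ n : ℕ, Real.exp (-(((n : ℝ) + 1) * t)) = Real.exp (-t) ^ (n+1) := by
    intro n; rw [← Real.exp_nat_mul]; push_cast; ring_nf
  have h1 := tsum_pow_div_one_sub_eq_tsum_sigma hr 0
  rw [tsum_pnat_eq_tsum_succ (f := fun n : ℕ => ((n:ℝ) ^ 0 * Real.exp (-t) ^ n / (1 - Real.exp (-t) ^ n))),
    tsum_pnat_eq_tsum_succ (f := fun n : ℕ => (((ArithmeticFunction.sigma 0 n : ℕ) : ℝ) * Real.exp (-t) ^ n))] at h1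
  simp only [pow_zero, one_mul, ArithmeticFunction.sigma_zero_apply] at h1
  simp only [hpow]
  rw [← h1]
  have hlog : HasSum (fun m : ℕ => Real.exp (-t) ^ (m+1) / (((m:ℝ)+1) * t)) (-Real.log (1 - Real.exp (-t)) / t) := by
    have := (Real.hasSum_pow_div_log_of_abs_lt_one hr).div_const t
    simpa only [div_div] using this
  have hsum : Summable (fun m : ℕ => Real.exp (-t) ^ (m+1) / (1 - Real.exp (-t) ^ (m+1))) := by
    have hg : Summable (fun m : ℕ => Real.exp (-t) ^ m / (1 - Real.exp (-t))) :=
      (summable_geometric_of_norm_lt_one hr).div_const _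
    have hle : ∀ m : ℕ, Real.exp (-t) ^ (m+1) ≤ Real.exp (-t) := fun m =>
      pow_le_of_le_one hq0.le (by linarith) (by simp)
    refine Summable.of_nonneg_of_le (fun m => ?_) (fun m => ?_) hg
    · have := hle m
      exact div_nonneg (by positivity) (by linarith)
    · have := hle m
      have := pow_le_pow_of_le_one hq0.le (by linarith) (Nat.le_succ m)
      gcongr
  refine ⟨_, (hsum.hasSum.sub hlog).congr_fun ?_, by ring⟩
  intro m
  rw [wG_eq (by positivity), hpow]

/-- Small-`t` asymptotics of the trace of the wave group:
`Θ(t) = -(ln t)/t + γ/t + 1/4 + O(t)` as `t → 0⁺`. -/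
theorem trace_wave_group_asymptotics :
    (fun t : ℝ =>
        (∑' n : ℕ, ((Nat.divisors (n + 1)).card : ℝ) * Real.exp (-(((n : ℝ) + 1) * t)))
          - (-(Real.log t) / t + Real.eulerMascheroniConstant / t + 1 / 4))
      =O[nhdsWithin 0 (Set.Ioi 0)] fun t : ℝ => t := by
  obtain ⟨K, hK0, hK⟩ := wG_bound
  refine IsBigO.of_bound (K + 1) ?_
  filter_upwards [Ioc_mem_nhdsGT (zero_lt_one' ℝ)] with t ht
  obtain ⟨S, hS, e⟩ := theta_hasSum ht.1
  have a := wG_final hK0 hK ht.1 ht.2 hS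
  have b := log_bound ht.1
  rw [e, Real.norm_eq_abs, Real.norm_eq_abs, abs_of_pos ht.1]
  have := abs_add_le (S - (Real.eulerMascheroniConstant / t - 1 / 4))
    (-Real.log (1 - Real.exp (-t)) / t - (-Real.log t / t + 1 / 2))
  refine le_trans (le_of_eq ?_) (this.trans ((add_le_add a b).trans (le_of_eq ?_)))
  · congr 1; ring
  · ring
end

section
/- The generalized gamma function satisfies the product formula 1/Γ̃(k) = e^{γ̃ k} ∏_{n=1}^∞ e^{-γk/n} / Γ(1 + k/n) for all k ∈ ℂ. -/
open Filter

/-- The Weierstrass elementary factor. -/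
noncomputable def wfac (w : ℂ) : ℂ := (1 + w) * Complex.exp (-w)

lemma wfac_bound (w : ℂ) (R : ℝ) (h : ‖w‖ ≤ R) :
    ‖wfac w - 1‖ ≤ ((1 + R) * Real.exp R + 1) * ‖w‖ ^ 2 := by
  have h1 := Complex.norm_exp_sub_sum_le_norm_mul_exp (-w) 2
  simp only [Finset.sum_range_succ, Finset.sum_range_zero, norm_neg] at h1
  norm_num at h1
  have e : wfac w - 1 = (1 + w) * (Complex.exp (-w) - (1 + -w)) - w ^ 2 := by
    unfold wfac; ring
  rw [e]
  have hR : 0 ≤ R := (norm_nonneg w).trans h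
  have h2 : ‖1 + w‖ ≤ 1 + R := by
    refine (norm_add_le _ _).trans ?_
    simpa using h
  calc _ ≤ ‖(1 + w) * (Complex.exp (-w) - (1 + -w))‖ + ‖w ^ 2‖ := norm_sub_le _ _
    _ ≤ (1 + R) * (‖w‖ ^ 2 * Real.exp R) + ‖w‖ ^ 2 := by
        rw [norm_mul, norm_pow]
        gcongr
        refine h1.trans ?_
        gcongr
    _ = _ := by ring

lemma wfac_mult {ι : Type*} (w : ι → ℂ) (R : ℝ) (h : ∀ i, ‖w i‖ ≤ R)
    (hs : Summable fun i => ‖w i‖ ^ 2) : Multipliable fun i => wfac (w i) := by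
  have : Multipliable fun i => (1 + (wfac (w i) - 1)) := by
    apply multipliable_one_add_of_summable
    exact Summable.of_nonneg_of_le (fun _ => norm_nonneg _) (fun i => wfac_bound _ R (h i))
      (hs.mul_left _)
  simpa using this

lemma sum_sq : Summable fun n : ℕ => (1 / ((n : ℝ) + 1)) ^ 2 := by
  have := (summable_nat_add_iff 1).2 (Real.summable_one_div_nat_pow (p := 2).2 (by norm_num))
  simpa using this

lemma norm_cast_succ (n : ℕ) : ‖(n : ℂ) + 1‖ = (n : ℝ) + 1 := by
  have := Complex.norm_natCast (n + 1)
  push_cast at this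
  exact this

lemma wfac_partial (z : ℂ) (hz : z ≠ 0) (hp : ∀ m : ℕ, 1 + z ≠ -m) (n : ℕ) (hn : n ≠ 0) :
    ∏ a ∈ Finset.range n, wfac (z / ((a : ℂ) + 1)) =
      Complex.exp (-(z * (Real.eulerMascheroniSeq' n : ℝ))) / (z * Complex.GammaSeq z n) := by
  have hne : ∀ a : ℕ, (a : ℂ) + 1 ≠ 0 := fun a => by exact_mod_cast Nat.succ_ne_zero a
  have hne' : ∀ a : ℕ, z + ((a : ℂ) + 1) ≠ 0 := fun a h => hp a (by linear_combination h)
  have e1 : ∏ j ∈ Finset.range (n + 1), (z + j) =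
      z * n.factorial * ∏ a ∈ Finset.range n, (1 + z / ((a : ℂ) + 1)) := by
    rw [Finset.prod_range_succ', ← Finset.prod_range_add_one_eq_factorial]
    push_cast
    rw [mul_assoc, ← Finset.prod_mul_distrib, mul_comm, add_zero]
    congr 1
    refine Finset.prod_congr rfl fun a _ => ?_
    have := hne a
    field_simp
    ring
  have hP : ∏ a ∈ Finset.range n, (1 + z / ((a : ℂ) + 1)) ≠ 0 := by
    refine Finset.prod_ne_zero_iff.2 fun a _ h => hne' a ?_
    have := hne a
    field_simp at h
    linear_combination h
  have e2 : ∏ a ∈ Finset.range n, Complex.exp (-(z / ((a : ℂ) + 1))) =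
      Complex.exp (-(z * ((harmonic n : ℚ) : ℂ))) := by
    rw [← Complex.exp_sum, harmonic]
    push_cast
    rw [Finset.mul_sum, Finset.sum_neg_distrib]
    simp only [div_eq_mul_inv]
  have hn' : (n : ℂ) ≠ 0 := by exact_mod_cast hn
  have hf : (n.factorial : ℂ) ≠ 0 := by exact_mod_cast n.factorial_ne_zero
  have e3 : Complex.exp (-(z * (Real.eulerMascheroniSeq' n : ℝ))) =
      (n : ℂ) ^ z * Complex.exp (-(z * ((harmonic n : ℚ) : ℂ))) := by
    rw [Complex.cpow_def_of_ne_zero hn', ← Complex.exp_add, Real.eulerMascheroniSeq', if_neg hn]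
    push_cast
    congr 1
    ring
  have hc : (n : ℂ) ^ z ≠ 0 := by simp [Complex.cpow_eq_zero_iff, hn']
  simp only [wfac, Finset.prod_mul_distrib]
  rw [e2, e3, Complex.GammaSeq, e1]
  field_simp

lemma gamma_hasProd (z : ℂ) :
    HasProd (fun a : ℕ => wfac (z / ((a : ℂ) + 1)))
      (Complex.exp (-((Real.eulerMascheroniConstant : ℂ) * z)) / Complex.Gamma (1 + z)) := by
  by_cases hp : ∃ m : ℕ, 1 + z = -m
  · obtain ⟨m, hm⟩ := hp
    rw [hm, Complex.Gamma_neg_nat_eq_zero, div_zero]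
    refine hasProd_zero_of_exists_eq_zero ⟨m, ?_⟩
    have : (m : ℂ) + 1 ≠ 0 := by exact_mod_cast Nat.succ_ne_zero m
    have hz : z = -((m : ℂ) + 1) := by linear_combination hm
    rw [hz, neg_div, div_self this]
    simp [wfac]
  push Not at hp
  by_cases hz : z = 0
  · subst hz
    simp [wfac]
  have hM : Multipliable fun a : ℕ => wfac (z / ((a : ℂ) + 1)) := by
    refine wfac_mult _ ‖z‖ (fun a => ?_) ?_
    · rw [norm_div, norm_cast_succ]
      exact div_le_self (norm_nonneg _) (by linarith [Nat.cast_nonneg (α := ℝ) a])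
    · refine (sum_sq.mul_left (‖z‖ ^ 2)).congr fun a => ?_
      rw [norm_div, norm_cast_succ]
      ring
  have hg : Complex.Gamma (1 + z) = z * Complex.Gamma z := by
    rw [add_comm, Complex.Gamma_add_one z hz]
  have hg0 : z * Complex.Gamma z ≠ 0 := by
    rw [← hg]; exact Complex.Gamma_ne_zero hp
  have hl : Tendsto (fun n => ∏ a ∈ Finset.range n, wfac (z / ((a : ℂ) + 1))) atTop
      (nhds (Complex.exp (-(z * (Real.eulerMascheroniConstant : ℝ))) / (z * Complex.Gamma z))) := by
    have t1 : Tendsto (fun n => Complex.exp (-(z * (Real.eulerMascheroniSeq' n : ℝ)))) atTop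
        (nhds (Complex.exp (-(z * (Real.eulerMascheroniConstant : ℝ))))) := by
      refine (Complex.continuous_exp.tendsto _).comp (Tendsto.neg (Tendsto.const_mul _ ?_))
      exact (Complex.continuous_ofReal.tendsto _).comp Real.tendsto_eulerMascheroniSeq'
    refine (t1.div ((Complex.GammaSeq_tendsto_Gamma z).const_mul z) hg0).congr' ?_
    filter_upwards [eventually_ne_atTop 0] with n hn
    exact (wfac_partial z hz hp n hn).symm
  have := tendsto_nhds_unique hM.hasProd.tendsto_prod_nat hl
  rw [hg, mul_comm (Real.eulerMascheroniConstant : ℂ), ← this]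
  exact hM.hasProd

lemma double_mult (k : ℂ) :
    Multipliable fun p : ℕ × ℕ => wfac (k / ((p.1 : ℂ) + 1) / ((p.2 : ℂ) + 1)) := by
  refine wfac_mult _ ‖k‖ (fun p => ?_) ?_
  · rw [norm_div, norm_div, norm_cast_succ, norm_cast_succ]
    have h1 := Nat.cast_nonneg (α := ℝ) p.1
    have h2 := Nat.cast_nonneg (α := ℝ) p.2
    exact (div_le_self (by positivity) (by linarith)).trans
      (div_le_self (norm_nonneg _) (by linarith))
  · refine ((sum_sq.mul_of_nonneg sum_sq (fun _ => by positivity)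
      (fun _ => by positivity)).mul_left (‖k‖ ^ 2)).congr fun p => ?_
    rw [norm_div, norm_div, norm_cast_succ, norm_cast_succ]
    ring

lemma divisor_hasProd (k P : ℂ)
    (h : HasProd (fun p : ℕ × ℕ => wfac (k / ((p.1 : ℂ) + 1) / ((p.2 : ℂ) + 1))) P) :
    HasProd (fun n : ℕ => wfac (k / ((n : ℂ) + 1)) ^ (Nat.divisors (n + 1)).card) P := by
  have h1 : HasProd (fun p : ℕ+ × ℕ+ => wfac (k / ((p.1 : ℕ) * (p.2 : ℕ) : ℕ))) P := by
    rw [← (Equiv.prodCongr Equiv.pnatEquivNat Equiv.pnatEquivNat).symm.hasProd_iff]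
    convert h using 2 with p
    simp [div_div]
  have h2 := HasProd.sigma (sigmaAntidiagonalEquivProd.hasProd_iff.2 h1)
    (g := fun n : ℕ+ => wfac (k / (n : ℕ)) ^ (Nat.divisors n).card) (fun n => by
      have := hasProd_fintype (fun c : Nat.divisorsAntidiagonal n => wfac (k / (n : ℕ)))
      have hc : (Nat.divisorsAntidiagonal n).card = (Nat.divisors n).card := by
        rw [← Nat.map_div_right_divisors, Finset.card_map]
      rw [Finset.prod_const, Finset.card_univ, Fintype.card_coe, hc] at this
      convert this using 1
      funext c
      exact congrArg (fun m : ℕ => wfac (k / (m : ℂ))) (divisorsAntidiagonalFactors_eq c))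
  have h3 := Equiv.pnatEquivNat.symm.hasProd_iff.2 h2
  simpa [Function.comp_def] using h3

/-- Product formula for the generalized gamma function:
`1/Γ̃(k) = e^{γ̃k} ∏ₙ e^{-γk/n} / Γ(1 + k/n)` for all `k ∈ ℂ`,
where `1/Γ̃(k) = e^{γ̃k} ∏ₙ [(1+k/n)e^{-k/n}]^{d(n)}` and `γ̃ = γ² - 2γ₁`. -/
theorem gammaTilde_product_formula (γ₁ : ℝ)
    (hγ₁ : Tendsto (fun m : ℕ =>
        (∑ l ∈ Finset.Icc 1 m, Real.log l / l) - (Real.log m) ^ 2 / 2) atTop (nhds γ₁))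
    (k : ℂ) :
    Complex.exp (((Real.eulerMascheroniConstant ^ 2 - 2 * γ₁ : ℝ) : ℂ) * k) *
        ∏' n : ℕ, ((1 + k / ((n : ℂ) + 1)) *
            Complex.exp (-(k / ((n : ℂ) + 1)))) ^ (Nat.divisors (n + 1)).card
      = Complex.exp (((Real.eulerMascheroniConstant ^ 2 - 2 * γ₁ : ℝ) : ℂ) * k) *
        ∏' n : ℕ, Complex.exp (-((Real.eulerMascheroniConstant : ℂ) * k / ((n : ℂ) + 1)))
            / Complex.Gamma (1 + k / ((n : ℂ) + 1)) := by
  congr 1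
  have h := (double_mult k).hasProd
  have hA := divisor_hasProd k _ h
  have hB := h.prod_fiberwise (fun n => gamma_hasProd (k / ((n : ℂ) + 1)))
  simp only [mul_div_assoc]
  exact hA.tprod_eq.trans hB.tprod_eq.symm
end
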